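/- Let b < 0 and c ∈ ℝ. Then the entrywise integral ∫₀^∞ e^{2sb} · M(s) ds, where M(s) is the 2×2 matrix with rows (1 + s²c², sc) and (sc, 1), converges and equals the 2×2 matrix with rows (−1/(2b) − c²/(4b³), c/(4b²)) and (c/(4b²), −1/(2b)). -/

import Mathlib

open MeasureTheory

/-- Integrability and value of `∫₀^∞ sⁿ e^{-rs} ds` for `r > 0`. -/
lemma integrableOn_and_integral_pow_mul_exp_neg_mul (n : ℕ) {r : ℝ} (hr : 0 < r) :
    IntegrableOn (fun s : ℝ => s ^ n * Real.exp (-(r * s))) (Set.Ici 0) ∧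
      ∫ s in Set.Ici (0 : ℝ), s ^ n * Real.exp (-(r * s)) = n.factorial / r ^ (n + 1) := by
  have hint : ∫ s in Set.Ioi (0 : ℝ), s ^ n * Real.exp (-(r * s)) =
      n.factorial / r ^ (n + 1) := by
    have h := Real.integral_rpow_mul_exp_neg_mul_Ioi (a := (n : ℝ) + 1) (by positivity) hr
    rw [Real.Gamma_nat_eq_factorial] at h
    simp only [add_sub_cancel_right, Real.rpow_natCast] at h
    rw [h, ← Nat.cast_succ, Real.rpow_natCast, one_div, inv_pow, div_eq_inv_mul]
  refine ⟨?_, by rw [integral_Ici_eq_integral_Ioi, hint]⟩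
  rw [integrableOn_Ici_iff_integrableOn_Ioi]
  refine not_imp_comm.mp integral_undef ?_
  rw [hint]
  positivity

/-- For `b < 0` and `c ∈ ℝ`, the entrywise integral
`∫₀^∞ e^{2sb} !![1 + s²c², sc; sc, 1] ds` converges and equals
`!![-1/(2b) - c²/(4b³), c/(4b²); c/(4b²), -1/(2b)]`. -/
theorem stmt11 (b c : ℝ) (hb : b < 0)
    (M : ℝ → Matrix (Fin 2) (Fin 2) ℝ)
    (hM : ∀ s : ℝ, M s = Real.exp (2 * s * b) • !![1 + s ^ 2 * c ^ 2, s * c; s * c, 1]) :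
    (∀ i j, IntegrableOn (fun s => M s i j) (Set.Ici (0:ℝ))) ∧
    (Matrix.of fun i j => ∫ s in Set.Ici (0:ℝ), M s i j) =
      !![-1 / (2 * b) - c ^ 2 / (4 * b ^ 3), c / (4 * b ^ 2);
         c / (4 * b ^ 2), -1 / (2 * b)] := by
  have hr : 0 < -(2 * b) := by linarith
  have hexp (s : ℝ) : -(-(2 * b) * s) = 2 * s * b := by ring
  obtain ⟨i0, v0⟩ := integrableOn_and_integral_pow_mul_exp_neg_mul 0 hr
  obtain ⟨i1, v1⟩ := integrableOn_and_integral_pow_mul_exp_neg_mul 1 hr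
  obtain ⟨i2, v2⟩ := integrableOn_and_integral_pow_mul_exp_neg_mul 2 hr
  simp only [hexp, pow_zero, one_mul, pow_one] at i0 i1 i2 v0 v1 v2
  have e00 : (fun s => M s 0 0) = fun s => Real.exp (2 * s * b) +
      c ^ 2 * (s ^ 2 * Real.exp (2 * s * b)) := by
    ext s; simp [hM]; ring
  have e01 : (fun s => M s 0 1) = fun s => c * (s * Real.exp (2 * s * b)) := by
    ext s; simp [hM]; ring
  have e10 : (fun s => M s 1 0) = fun s => c * (s * Real.exp (2 * s * b)) := by
    ext s; simp [hM]; ring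
  have e11 : (fun s => M s 1 1) = fun s => Real.exp (2 * s * b) := by
    ext s; simp [hM]
  have hb0 : b ≠ 0 := hb.ne
  constructor
  · intro i j
    fin_cases i <;> fin_cases j
    · exact e00 ▸ i0.add (i2.const_mul _)
    · exact e01 ▸ i1.const_mul _
    · exact e10 ▸ i1.const_mul _
    · exact e11 ▸ i0
  · ext i j
    fin_cases i <;> fin_cases j
    · change ∫ s in Set.Ici (0 : ℝ), (fun s => M s 0 0) s = -1 / (2 * b) - c ^ 2 / (4 * b ^ 3)
      rw [e00, integral_add i0 (i2.const_mul _), integral_const_mul, v0, v2]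
      simp [Nat.factorial]
      field_simp
      ring
    · change ∫ s in Set.Ici (0 : ℝ), (fun s => M s 0 1) s = c / (4 * b ^ 2)
      rw [e01, integral_const_mul, v1]
      simp [Nat.factorial]
      field_simp
      ring
    · change ∫ s in Set.Ici (0 : ℝ), (fun s => M s 1 0) s = c / (4 * b ^ 2)
      rw [e10, integral_const_mul, v1]
      simp [Nat.factorial]
      field_simp
      ring
    · change ∫ s in Set.Ici (0 : ℝ), (fun s => M s 1 1) s = -1 / (2 * b)
      rw [e11, v0]
      simp [Nat.factorial]
      field_simp
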